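/- Let b ∈ C^∞(ℝ) satisfy: inf_{x∈ℝ}|b(x)| > 0, and there exists a compact set B ⊆ ℝ such that inf_{x∈B^c}|b'(x)| > 0 and for every x ∈ B some derivative b^{(j)}(x) with j ≥ 1 is nonzero. Then there exist a finite set 𝒩 ⊂ B, a positive constant c and an integer m ≥ 2 such that (b(x)b'(x))² ≥ min_{z∈𝒩} c^{m/2} (1 ∧ |x − z|^m) for all x ∈ ℝ. -/

import Mathlib

open Set

noncomputable section

open Filter Topology in
/-- A smooth function that does not vanish to infinite order at `z` is bounded below near `z`
by a multiple of a power of the distance to `z`. -/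
lemma exists_eventually_mul_abs_sub_pow_le {f : ℝ → ℝ} (hf : ContDiff ℝ (⊤ : ℕ∞) f) {z : ℝ}
    (hz : ∃ j, iteratedDeriv j f z ≠ 0) :
    ∃ c : ℝ, 0 < c ∧ ∃ n : ℕ, ∀ᶠ x in 𝓝 z, c * |x - z| ^ n ≤ |f x| := by
  classical
  obtain ⟨n, hn, hmin⟩ : ∃ n, iteratedDeriv n f z ≠ 0 ∧ ∀ k < n, iteratedDeriv k f z = 0 :=
    ⟨Nat.find hz, Nat.find_spec hz, fun k hk => not_not.1 (Nat.find_min hz hk)⟩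
  set a : ℝ := (n.factorial : ℝ)⁻¹ * iteratedDeriv n f z with ha
  have ha0 : 0 < |a| := abs_pos.2 (mul_ne_zero (by positivity) hn)
  have htaylor (x : ℝ) : taylorWithinEval f n univ z x = a * (x - z) ^ n := by
    rw [taylor_within_apply, Finset.sum_range_succ, Finset.sum_eq_zero]
    · simp only [iteratedDerivWithin_univ, smul_eq_mul, ha]
      ring
    · intro k hk
      simp [iteratedDerivWithin_univ, hmin k (Finset.mem_range.1 hk)]
  refine ⟨|a| / 2, by positivity, n, ?_⟩
  have hf' : ContDiff ℝ n f := hf.of_le (by exact_mod_cast le_top)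
  filter_upwards [(taylor_isLittleO_univ (x₀ := z) hf').def (half_pos ha0)] with x hx
  rw [htaylor, Real.norm_eq_abs, Real.norm_eq_abs, abs_pow] at hx
  have h := abs_sub_abs_le_abs_sub (a * (x - z) ^ n) (f x)
  rw [abs_sub_comm, abs_mul, abs_pow] at h
  linarith

open Filter Topology in
/-- A smooth function without zeros of infinite order in a compact set is bounded below there by
powers of the distances to finitely many of its points. -/
lemma IsCompact.exists_finset_mul_min_abs_sub_pow_le {f : ℝ → ℝ} (hf : ContDiff ℝ (⊤ : ℕ∞) f)
    {K : Set ℝ} (hK : IsCompact K) (hfK : ∀ x ∈ K, ∃ j, iteratedDeriv j f x ≠ 0) :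
    ∃ (N : Finset ℝ) (c : ℝ) (n : ℕ), (N : Set ℝ) ⊆ K ∧ 0 < c ∧
      ∀ x ∈ K, ∃ z ∈ N, c * min 1 |x - z| ^ n ≤ |f x| := by
  classical
  refine hK.induction_on (p := fun S => ∃ (N : Finset ℝ) (c : ℝ) (n : ℕ), (N : Set ℝ) ⊆ K ∧
    0 < c ∧ ∀ x ∈ S, ∃ z ∈ N, c * min 1 |x - z| ^ n ≤ |f x|) ?_ ?_ ?_ ?_
  · exact ⟨∅, 1, 0, by simp, one_pos, by simp⟩
  · rintro S T hST ⟨N, c, n, hN, hc, h⟩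
    exact ⟨N, c, n, hN, hc, fun x hx => h x (hST hx)⟩
  · rintro S T ⟨N₁, c₁, n₁, hN₁, hc₁, h₁⟩ ⟨N₂, c₂, n₂, hN₂, hc₂, h₂⟩
    have hmono {c c' : ℝ} {n n' : ℕ} (hc : 0 < c) (hcc : c ≤ c') (hnn : n' ≤ n) (t : ℝ) :
        c * min 1 |t| ^ n ≤ c' * min 1 |t| ^ n' :=
      mul_le_mul hcc (pow_le_pow_of_le_one (by positivity) (min_le_left _ _) hnn)
        (by positivity) (hc.le.trans hcc)
    refine ⟨N₁ ∪ N₂, min c₁ c₂, max n₁ n₂, by simp [hN₁, hN₂], lt_min hc₁ hc₂, ?_⟩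
    rintro x (hx | hx)
    · obtain ⟨z, hz, h⟩ := h₁ x hx
      exact ⟨z, Finset.mem_union_left _ hz, (hmono (lt_min hc₁ hc₂) (min_le_left _ _)
        (le_max_left _ _) _).trans h⟩
    · obtain ⟨z, hz, h⟩ := h₂ x hx
      exact ⟨z, Finset.mem_union_right _ hz, (hmono (lt_min hc₁ hc₂) (min_le_right _ _)
        (le_max_right _ _) _).trans h⟩
  · intro z hz
    obtain ⟨c, hc, n, h⟩ := exists_eventually_mul_abs_sub_pow_le hf (hfK z hz)
    refine ⟨_, mem_nhdsWithin_of_mem_nhds h, {z}, c, n, by simpa using hz, hc, fun x hx => ?_⟩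
    refine ⟨z, Finset.mem_singleton_self z, le_trans ?_ hx⟩
    gcongr
    exact min_le_right _ _

/-- A differentiable function on the line whose derivative is bounded below by a positive constant
has a zero. -/
lemma exists_eq_zero_of_le_deriv {f : ℝ → ℝ} (hf : Differentiable ℝ f) {ε : ℝ} (hε : 0 < ε)
    (h : ∀ x, ε ≤ deriv f x) : ∃ x, f x = 0 := by
  have hr : 0 ≤ |f 0| / ε := by positivity
  have hεr : ε * (|f 0| / ε) = |f 0| := by field_simp
  have h₁ := mul_sub_le_image_sub_of_le_deriv hf h hr
  have h₂ := mul_sub_le_image_sub_of_le_deriv hf h (neg_nonpos.2 hr)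
  have := neg_abs_le (f 0)
  have := le_abs_self (f 0)
  exact mem_range_of_exists_le_of_exists_ge hf.continuous
    ⟨-(|f 0| / ε), by linarith⟩ ⟨|f 0| / ε, by linarith⟩

/-- A `C¹` function on the line whose derivative is bounded away from zero has a zero. -/
lemma exists_eq_zero_of_le_abs_deriv {f : ℝ → ℝ} (hf : ContDiff ℝ 1 f) {ε : ℝ} (hε : 0 < ε)
    (h : ∀ x, ε ≤ |deriv f x|) : ∃ x, f x = 0 := by
  have hd : Differentiable ℝ f := hf.differentiable one_ne_zero
  have hne : ∀ x ∈ univ, deriv f x ≠ 0 := fun x _ => abs_pos.1 (hε.trans_le (h x))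
  rcases hasDerivWithinAt_forall_lt_or_forall_gt_of_forall_ne convex_univ
    (fun x _ => (hd x).hasDerivAt.hasDerivWithinAt) hne with hneg | hpos
  · obtain ⟨x, hx⟩ := exists_eq_zero_of_le_deriv hd.neg hε fun x => by
      rw [deriv.neg, ← abs_of_neg (hneg x (mem_univ x))]
      exact h x
    exact ⟨x, by simpa using hx⟩
  · exact exists_eq_zero_of_le_deriv hd hε fun x => by
      rw [← abs_of_pos (hpos x (mem_univ x))]
      exact h x

lemma min_one_pow_le (t : ℝ) (n : ℕ) : min 1 (t ^ n) ≤ min 1 t ^ n := by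
  rcases le_total 1 t with h | h
  · simp [min_eq_left h]
  · simp [min_eq_right h]

/-- the key lower bound (4.8).  If `b ∈ C^∞(ℝ)` satisfies
`inf_x |b(x)| > 0` and there is a compact set `B` with `inf_{x∈Bᶜ} |b'(x)| > 0` and, for each
`x ∈ B`, some derivative `b^{(j)}(x)` (`j ≥ 1`) nonzero, then there are a finite set
`𝒩 ⊆ B`, a constant `c > 0` and an integer `m ≥ 2` such that
`(b(x)b'(x))² ≥ min_{z∈𝒩} c^{m/2} (1 ∧ |x−z|^m)` for all `x ∈ ℝ`. -/
theorem bb'_squared_lower_bound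
    (b : ℝ → ℝ) (hb : ContDiff ℝ (⊤ : ℕ∞) b)
    (hb0 : ∃ ε : ℝ, 0 < ε ∧ ∀ x : ℝ, ε ≤ |b x|)
    (B : Set ℝ) (hBcompact : IsCompact B)
    (hbd : ∃ ε : ℝ, 0 < ε ∧ ∀ x ∉ B, ε ≤ |deriv b x|)
    (hbB : ∀ x ∈ B, ∃ j : ℕ, 1 ≤ j ∧ iteratedDeriv j b x ≠ 0) :
    ∃ (N : Finset ℝ) (c : ℝ) (m : ℕ), (N : Set ℝ) ⊆ B ∧ 0 < c ∧ 2 ≤ m ∧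
      ∀ x : ℝ, ∃ z ∈ N,
        c ^ ((m : ℝ)/2) * min 1 (|x - z| ^ m) ≤ (b x * deriv b x)^2 := by
  obtain ⟨ε, hε, hbε⟩ := hb0
  obtain ⟨δ, hδ, hbδ⟩ := hbd
  have hBne : B.Nonempty := by
    by_contra hB
    rw [not_nonempty_iff_eq_empty] at hB
    obtain ⟨x, hx⟩ := exists_eq_zero_of_le_abs_deriv (hb.of_le (by exact_mod_cast le_top)) hδ
      fun x => hbδ x (by simp [hB])
    have := hbε x
    rw [hx, abs_zero] at this
    linarith
  obtain ⟨N, c, n, hNB, hc, hN⟩ := hBcompact.exists_finset_mul_min_abs_sub_pow_le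
    (f := deriv b) (contDiff_infty_iff_deriv.1 hb).2 fun x hx => by
      obtain ⟨j, hj, hjx⟩ := hbB x hx
      obtain ⟨k, rfl⟩ := Nat.exists_eq_add_of_le' hj
      exact ⟨k, by rwa [← iteratedDeriv_succ']⟩
  obtain ⟨y, hy⟩ := hBne
  obtain ⟨w, hw, -⟩ := hN y hy
  set C : ℝ := (ε * min c δ) ^ 2
  have hcδ : 0 < min c δ := lt_min hc hδ
  have hC : 0 < C := by positivity
  have hpow : (C ^ (2 / ((2 * (n + 1) : ℕ) : ℝ))) ^ (((2 * (n + 1) : ℕ) : ℝ) / 2) = C := by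
    rw [← Real.rpow_mul hC.le, div_mul_div_cancel₀ (by positivity), div_self two_ne_zero,
      Real.rpow_one]
  refine ⟨N, C ^ (2 / ((2 * (n + 1) : ℕ) : ℝ)), 2 * (n + 1), hNB, by positivity, by omega, ?_⟩
  intro x
  rw [hpow]
  obtain ⟨z, hz, h⟩ : ∃ z ∈ N, min c δ * min 1 |x - z| ^ (n + 1) ≤ |deriv b x| := by
    have hle (z : ℝ) (k : ℕ) : min 1 |x - z| ^ k ≤ 1 :=
      pow_le_one₀ (by positivity) (min_le_left _ _)
    by_cases hx : x ∈ B
    · obtain ⟨z, hz, h⟩ := hN x hx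
      refine ⟨z, hz, le_trans ?_ h⟩
      exact mul_le_mul (min_le_left _ _) (pow_le_pow_of_le_one (by positivity) (min_le_left _ _)
        n.le_succ) (by positivity) hc.le
    · exact ⟨w, hw, (mul_le_of_le_one_right hcδ.le (hle _ _)).trans
        ((min_le_right _ _).trans (hbδ x hx))⟩
  refine ⟨z, hz, ?_⟩
  calc C * min 1 (|x - z| ^ (2 * (n + 1)))
      ≤ C * min 1 |x - z| ^ (2 * (n + 1)) := by
        gcongr
        exact min_one_pow_le _ _
    _ = (ε * (min c δ * min 1 |x - z| ^ (n + 1))) ^ 2 := by ring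
    _ ≤ (|b x| * |deriv b x|) ^ 2 := by
        gcongr
        exact hbε x
    _ = (b x * deriv b x) ^ 2 := by rw [← abs_mul, sq_abs]
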